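/- arXiv:1505.02613 — 3 statements merged into one kernel-verified Lean document; each statement's English description precedes it below -/
import Mathlib

section
/- (Theorem 4) Let z = (z_1,...,z_p) be a random vector with independent standardized components having finite fourth moments, and write γ_k = E[z_k^3] and κ_k = E[z_k^4] − 3. Then for every orthogonal matrix U ∈ ℝ^{p×p} with rows u_1,...,u_p and every α ∈ [0,1], α ∑_{k=1}^p (E[(u_k^T z)^3])^2 + (1−α) ∑_{k=1}^p (E[(u_k^T z)^4] − 3)^2 ≤ α ∑_{k=1}^p γ_k^2 + (1−α) ∑_{k=1}^p κ_k^2. -/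
open MeasureTheory ProbabilityTheory Matrix

open Finset in
/-- The inequality `∑ₖ (∑ⱼ Uₖⱼʳ cⱼ)² ≤ ∑ⱼ cⱼ²` for an orthogonal matrix and an exponent `r ≥ 2`,
with `r` written as `n + 2`. -/
lemma sum_sq_sum_pow_mul_le_of_mul_transpose_eq_one {ι : Type*} [Fintype ι] [DecidableEq ι]
    {U : Matrix ι ι ℝ} (hU : U * Uᵀ = 1) (n : ℕ) (c : ι → ℝ) :
    ∑ k, (∑ j, U k j ^ (n + 2) * c j) ^ 2 ≤ ∑ j, c j ^ 2 := by
  have hrow (k : ι) : ∑ j, U k j ^ 2 = 1 := by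
    simpa [mul_apply, sq] using congr_fun₂ hU k k
  have hU' : Uᵀ * U = 1 := mul_eq_one_comm.mp hU
  have hcol (j : ι) : ∑ k, U k j ^ 2 = 1 := by
    simpa [mul_apply, sq] using congr_fun₂ hU' j j
  have hle (k j : ι) : U k j ^ 2 ≤ 1 :=
    hrow k ▸ single_le_sum (f := fun j ↦ U k j ^ 2) (fun _ _ ↦ sq_nonneg _) (mem_univ j)
  calc ∑ k, (∑ j, U k j ^ (n + 2) * c j) ^ 2
      ≤ ∑ k, ∑ j, U k j ^ 2 * c j ^ 2 := by
        refine sum_le_sum fun k _ ↦ ?_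
        calc (∑ j, U k j ^ (n + 2) * c j) ^ 2
            = (∑ j, U k j * (U k j ^ (n + 1) * c j)) ^ 2 := by
              congr! 2 with j
              ring
          _ ≤ (∑ j, U k j ^ 2) * ∑ j, (U k j ^ (n + 1) * c j) ^ 2 :=
              sum_mul_sq_le_sq_mul_sq _ _ _
          _ = ∑ j, (U k j ^ 2) ^ n * (U k j ^ 2 * c j ^ 2) := by
              rw [hrow, one_mul]
              congr! 1 with j
              ring
          _ ≤ ∑ j, U k j ^ 2 * c j ^ 2 :=
              sum_le_sum fun j _ ↦ mul_le_of_le_one_left (by positivity)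
                (pow_le_one₀ (sq_nonneg _) (hle k j))
    _ = ∑ j, c j ^ 2 := by
        rw [sum_comm]
        simp_rw [← sum_mul, hcol, one_mul]

lemma MeasureTheory.MemLp.integrable_pow_of_le {Ω : Type*} [MeasurableSpace Ω] {μ : Measure Ω}
    [IsFiniteMeasure μ] {X : Ω → ℝ} {m n : ℕ} (hX : MemLp X n μ) (hmn : m ≤ n) :
    Integrable (fun ω ↦ X ω ^ m) μ := by
  refine (hX.mono_exponent (p := m) (by exact_mod_cast hmn)).integrable_norm_pow'.congr'
    (hX.aestronglyMeasurable.pow m) (.of_forall fun ω ↦ ?_)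
  simp

/-- The binomial formula for the moments of a sum of two independent random variables. -/
lemma ProbabilityTheory.IndepFun.integral_add_pow {Ω : Type*} [MeasurableSpace Ω] {μ : Measure Ω}
    [IsFiniteMeasure μ] {X Y : Ω → ℝ} (hXY : IndepFun X Y μ) {n : ℕ}
    (hX : MemLp X n μ) (hY : MemLp Y n μ) :
    ∫ ω, (X ω + Y ω) ^ n ∂μ = ∑ m ∈ Finset.range (n + 1),
      (∫ ω, X ω ^ m ∂μ) * (∫ ω, Y ω ^ (n - m) ∂μ) * n.choose m := by
  have hindep (a b : ℕ) : IndepFun (fun ω ↦ X ω ^ a) (fun ω ↦ Y ω ^ b) μ :=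
    hXY.comp (measurable_id.pow_const a) (measurable_id.pow_const b)
  simp_rw [add_pow]
  rw [integral_finsetSum]
  · refine Finset.sum_congr rfl fun m _ ↦ ?_
    rw [integral_mul_const, (hindep _ _).integral_fun_mul_eq_mul_integral
      (hX.aestronglyMeasurable.pow _) (hY.aestronglyMeasurable.pow _)]
  · intro m hm
    exact ((hindep _ _).integrable_mul
      (hX.integrable_pow_of_le (Finset.mem_range_succ_iff.mp hm))
      (hY.integrable_pow_of_le (Nat.sub_le _ _))).mul_const _

/-- The first four moments of a finite sum of independent centred random variables. -/
lemma ProbabilityTheory.iIndepFun.moments_sum_of_integral_eq_zero {Ω ι : Type*} [MeasurableSpace Ω]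
    {μ : Measure Ω} [IsProbabilityMeasure μ] {w : ι → Ω → ℝ} (hindep : iIndepFun w μ)
    (hmean : ∀ j, ∫ ω, w j ω ∂μ = 0) (hmom : ∀ j, MemLp (w j) 4 μ) (s : Finset ι) :
    ∫ ω, ∑ j ∈ s, w j ω ∂μ = 0 ∧
    ∫ ω, (∑ j ∈ s, w j ω) ^ 2 ∂μ = ∑ j ∈ s, ∫ ω, w j ω ^ 2 ∂μ ∧
    ∫ ω, (∑ j ∈ s, w j ω) ^ 3 ∂μ = ∑ j ∈ s, ∫ ω, w j ω ^ 3 ∂μ ∧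
    ∫ ω, (∑ j ∈ s, w j ω) ^ 4 ∂μ = 3 * (∑ j ∈ s, ∫ ω, w j ω ^ 2 ∂μ) ^ 2 +
      ∑ j ∈ s, (∫ ω, w j ω ^ 4 ∂μ - 3 * (∫ ω, w j ω ^ 2 ∂μ) ^ 2) := by
  classical
  induction s using Finset.induction_on with
  | empty => simp
  | insert i s hi ih =>
    obtain ⟨h1, h2, h3, h4⟩ := ih
    have hind : IndepFun (fun ω ↦ ∑ j ∈ s, w j ω) (w i) μ := by
      simpa [← Finset.sum_fn] using
        hindep.indepFun_finsetSum_of_notMem₀ (fun j ↦ (hmom j).aemeasurable) hi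
    have hS : MemLp (fun ω ↦ ∑ j ∈ s, w j ω) 4 μ := memLp_finsetSum s fun j _ ↦ hmom j
    have hadd {n : ℕ} (hn : n ≤ 4) := hind.integral_add_pow (n := n)
      (hS.mono_exponent (by exact_mod_cast hn)) ((hmom i).mono_exponent (by exact_mod_cast hn))
    have hadd1 := hadd (n := 1) (by norm_num)
    have hadd2 := hadd (n := 2) (by norm_num)
    have hadd3 := hadd (n := 3) (by norm_num)
    have hadd4 := hadd (n := 4) (by norm_num)
    simp [Finset.sum_range_succ, h1, h2, h3, h4, hmean, Nat.choose] at hadd1 hadd2 hadd3 hadd4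
    simp only [Finset.sum_insert hi, add_comm (w i _)]
    refine ⟨hadd1, by rw [hadd2, add_comm], by rw [hadd3, add_comm], ?_⟩
    rw [hadd4]
    simp only [Finset.sum_sub_distrib]
    ring



/-- Theorem 4: Let `z` have independent standardized components with finite
fourth moments, `γ_k = E[z_k^3]`, `κ_k = E[z_k^4] - 3`. Then for every orthogonal matrix
`U` with rows `u_1,...,u_p` and every `α ∈ [0,1]`,
`α ∑_k (E[(u_kᵀz)^3])^2 + (1-α) ∑_k (E[(u_kᵀz)^4] - 3)^2 ≤ α ∑_k γ_k^2 + (1-α) ∑_k κ_k^2`. -/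
theorem symmetric_pp_objective_le
    {Ω : Type*} [MeasurableSpace Ω] (μ : Measure Ω) [IsProbabilityMeasure μ]
    (p : ℕ) (z : Fin p → Ω → ℝ)
    (hindep : iIndepFun z μ)
    (hmean : ∀ k, ∫ ω, z k ω ∂μ = 0)
    (hvar : ∀ k, ∫ ω, (z k ω) ^ 2 ∂μ = 1)
    (hmom : ∀ k, MemLp (z k) 4 μ)
    (γ : Fin p → ℝ) (hγ : ∀ k, γ k = ∫ ω, (z k ω) ^ 3 ∂μ)
    (κ : Fin p → ℝ) (hκ : ∀ k, κ k = (∫ ω, (z k ω) ^ 4 ∂μ) - 3)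
    (U : Matrix (Fin p) (Fin p) ℝ) (hU : U * Uᵀ = 1)
    (α : ℝ) (hα : α ∈ Set.Icc (0 : ℝ) 1) :
    α * ∑ k, (∫ ω, (∑ j, U k j * z j ω) ^ 3 ∂μ) ^ 2
      + (1 - α) * ∑ k, ((∫ ω, (∑ j, U k j * z j ω) ^ 4 ∂μ) - 3) ^ 2
    ≤ α * ∑ k, (γ k) ^ 2 + (1 - α) * ∑ k, (κ k) ^ 2 := by
  have hrow (k : Fin p) : ∑ j, U k j ^ 2 = 1 := by
    simpa [mul_apply, sq] using congr_fun₂ hU k k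
  have hmoments (k : Fin p) :=
    (hindep.comp (fun j x ↦ U k j * x)
      fun j ↦ measurable_const_mul _).moments_sum_of_integral_eq_zero
      (fun j ↦ by simp [integral_const_mul, hmean]) (fun j ↦ (hmom j).const_mul _) Finset.univ
  simp only [Function.comp_apply, mul_pow, integral_const_mul, hvar, mul_one, hrow] at hmoments
  have hskew (k : Fin p) :
      ∫ ω, (∑ j, U k j * z j ω) ^ 3 ∂μ = ∑ j, U k j ^ (1 + 2) * γ j := by
    simp only [(hmoments k).2.2.1, hγ]
  have hkurt (k : Fin p) :
      (∫ ω, (∑ j, U k j * z j ω) ^ 4 ∂μ) - 3 = ∑ j, U k j ^ (2 + 2) * κ j := by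
    rw [(hmoments k).2.2.2, one_pow, mul_one, add_sub_cancel_left]
    refine Finset.sum_congr rfl fun j _ ↦ ?_
    rw [hκ]
    ring
  simp_rw [hskew, hkurt]
  have hα' : 0 ≤ 1 - α := sub_nonneg.mpr hα.2
  exact add_le_add
    (mul_le_mul_of_nonneg_left (sum_sq_sum_pow_mul_le_of_mul_transpose_eq_one hU 1 γ) hα.1)
    (mul_le_mul_of_nonneg_left (sum_sq_sum_pow_mul_le_of_mul_transpose_eq_one hU 2 κ) hα')
end

section
/- Let z = (z_1,...,z_p) be a random vector with independent standardized components having finite fourth moments, write γ_k = E[z_k^3] and κ_k = E[z_k^4] − 3, and let U = (u_{ik}) be a p × p orthogonal matrix. Then the compound cumulant matrices of Uz are explicitly C^3(Uz) = U diag(c_1 γ_1, ..., c_p γ_p) U^T where c_k = ∑_{i=1}^p u_{ik} is the k-th column sum of U, and C^4(Uz) = U diag(κ_1, ..., κ_p) U^T. -/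
open MeasureTheory ProbabilityTheory Matrix

/-- The third cumulant matrix `C^{3i}(x) = E[x_i · x xᵀ]` of a centered random vector. -/
noncomputable def thirdCumulantMatrix {Ω : Type*} [MeasurableSpace Ω] (μ : Measure Ω)
    {p : ℕ} (x : Fin p → Ω → ℝ) (i : Fin p) : Matrix (Fin p) (Fin p) ℝ :=
  Matrix.of fun k l => ∫ ω, x i ω * x k ω * x l ω ∂μ

/-- The fourth cumulant matrix `C^{4ij}(x)` of a centered random vector. -/
noncomputable def fourthCumulantMatrix {Ω : Type*} [MeasurableSpace Ω] (μ : Measure Ω)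
    {p : ℕ} (x : Fin p → Ω → ℝ) (i j : Fin p) : Matrix (Fin p) (Fin p) ℝ :=
  Matrix.of fun k l =>
    (∫ ω, x i ω * x j ω * (x k ω * x l ω) ∂μ)
      - (∫ ω, x i ω * x j ω ∂μ) * (∫ ω, x k ω * x l ω ∂μ)
      - (∫ ω, x i ω * x k ω ∂μ) * (∫ ω, x j ω * x l ω ∂μ)
      - (∫ ω, x j ω * x k ω ∂μ) * (∫ ω, x i ω * x l ω ∂μ)

section Moments

variable {Ω ι : Type*} [MeasurableSpace Ω] {μ : Measure Ω} {z : ι → Ω → ℝ}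

/-- A product of two functions in `L⁴` lies in `L²`. -/
lemma memLp_two_mul_of_memLp_four {f g : Ω → ℝ} (hf : MemLp f 4 μ) (hg : MemLp g 4 μ) :
    MemLp (fun ω => f ω * g ω) 2 μ := by
  have : ENNReal.HolderTriple 4 4 2 := ⟨by
    rw [← two_mul, show (4 : ENNReal) = 2 * 2 by norm_num,
      ENNReal.mul_inv (by simp) (by simp), ← mul_assoc,
      ENNReal.mul_inv_cancel (by simp) (by simp), one_mul]⟩
  exact hg.mul' hf

lemma integrable_mul_of_memLp_four [IsFiniteMeasure μ] (hmom : ∀ k, MemLp (z k) 4 μ)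
    (a b : ι) :
    Integrable (fun ω => z a ω * z b ω) μ :=
  (memLp_two_mul_of_memLp_four (hmom a) (hmom b)).integrable (by norm_num)

lemma integrable_mul_mul_of_memLp_four [IsFiniteMeasure μ] (hmom : ∀ k, MemLp (z k) 4 μ)
    (a b c : ι) :
    Integrable (fun ω => z a ω * z b ω * z c ω) μ :=
  (memLp_two_mul_of_memLp_four (hmom a) (hmom b)).integrable_mul
    ((hmom c).mono_exponent (p := 2) (by norm_num))

lemma integrable_mul_mul_mul_of_memLp_four (hmom : ∀ k, MemLp (z k) 4 μ) (a b c d : ι) :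
    Integrable (fun ω => z a ω * z b ω * (z c ω * z d ω)) μ :=
  (memLp_two_mul_of_memLp_four (hmom a) (hmom b)).integrable_mul
    (memLp_two_mul_of_memLp_four (hmom c) (hmom d))

lemma integral_mul_eq_ite [DecidableEq ι] (hindep : iIndepFun z μ)
    (hmean : ∀ k, ∫ ω, z k ω ∂μ = 0)
    (hvar : ∀ k, ∫ ω, z k ω ^ 2 ∂μ = 1) (hmom : ∀ k, MemLp (z k) 4 μ) (a b : ι) :
    ∫ ω, z a ω * z b ω ∂μ = if a = b then 1 else 0 := by
  split_ifs with h
  · subst h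
    simpa [sq] using hvar a
  · rw [(hindep.indepFun h).integral_fun_mul_eq_mul_integral (hmom a).1 (hmom b).1, hmean,
      zero_mul]

/-- A mixed fourth moment vanishes if one of its indices occurs only once. -/
lemma integral_mul_mul_mul_eq_zero (hindep : iIndepFun z μ) (hmean : ∀ k, ∫ ω, z k ω ∂μ = 0)
    (hmom : ∀ k, MemLp (z k) 4 μ) {a b c d : ι} (hb : a ≠ b) (hc : a ≠ c) (hd : a ≠ d) :
    ∫ ω, z a ω * (z b ω * z c ω * z d ω) ∂μ = 0 := by
  classical
  have hST : Disjoint ({a} : Finset ι) {b, c, d} := by simp [hb, hc, hd]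
  have hI : IndepFun (z a) (fun ω => z b ω * z c ω * z d ω) μ :=
    (hindep.indepFun_finset₀ {a} {b, c, d} hST fun k => (hmom k).1.aemeasurable).comp
      (φ := fun v : ({a} : Finset ι) → ℝ => v ⟨a, by simp⟩)
      (ψ := fun v : ({b, c, d} : Finset ι) → ℝ =>
        v ⟨b, by simp⟩ * v ⟨c, by simp⟩ * v ⟨d, by simp⟩)
      (by fun_prop) (by fun_prop)
  rw [hI.integral_fun_mul_eq_mul_integral (hmom a).1
    (((hmom b).1.mul (hmom c).1).mul (hmom d).1), hmean, zero_mul]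

lemma integral_mul_mul_eq_ite [DecidableEq ι] (hindep : iIndepFun z μ)
    (hmean : ∀ k, ∫ ω, z k ω ∂μ = 0)
    (hmom : ∀ k, MemLp (z k) 4 μ) (a b c : ι) :
    ∫ ω, z a ω * z b ω * z c ω ∂μ =
      if a = b then if a = c then ∫ ω, z a ω ^ 3 ∂μ else 0 else 0 := by
  have key : ∀ {a b c : ι}, a ≠ b → a ≠ c → ∫ ω, z a ω * (z b ω * z c ω) ∂μ = 0 := by
    intro a b c hb hc
    have hI := hindep.indepFun_mul_right₀ (fun k => (hmom k).1.aemeasurable) a b c hb hc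
    have h := hI.integral_fun_mul_eq_mul_integral (hmom a).1 ((hmom b).1.mul (hmom c).1)
    rw [hmean, zero_mul] at h
    exact h
  by_cases hab : a = b
  · subst hab
    by_cases hac : a = c
    · subst hac
      simp [pow_succ]
    · simpa [hac, mul_comm, mul_assoc, mul_left_comm] using key (Ne.symm hac) (Ne.symm hac)
  · rw [if_neg hab]
    by_cases hac : a = c
    · subst hac
      simpa [mul_comm, mul_assoc, mul_left_comm] using key (Ne.symm hab) (Ne.symm hab)
    · simpa [mul_assoc] using key hab hac

lemma integral_sq_mul_sq_eq_one (hindep : iIndepFun z μ)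
    (hvar : ∀ k, ∫ ω, z k ω ^ 2 ∂μ = 1) (hmom : ∀ k, MemLp (z k) 4 μ) {a b : ι} (h : a ≠ b) :
    ∫ ω, z a ω ^ 2 * z b ω ^ 2 ∂μ = 1 := by
  have hI : IndepFun (fun ω => z a ω ^ 2) (fun ω => z b ω ^ 2) μ :=
    (hindep.indepFun h).comp (φ := fun x => x ^ 2) (ψ := fun x => x ^ 2)
      (by fun_prop) (by fun_prop)
  rw [hI.integral_fun_mul_eq_mul_integral ((hmom a).1.pow 2) ((hmom b).1.pow 2), hvar, hvar,
    one_mul]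

/-- Fourth moments of independent standardized variables: the Gaussian pairings plus the excess
kurtosis on the diagonal. -/
lemma integral_mul_mul_mul_eq_ite [DecidableEq ι] (hindep : iIndepFun z μ)
    (hmean : ∀ k, ∫ ω, z k ω ∂μ = 0)
    (hvar : ∀ k, ∫ ω, z k ω ^ 2 ∂μ = 1) (hmom : ∀ k, MemLp (z k) 4 μ) (a b c d : ι) :
    ∫ ω, z a ω * z b ω * (z c ω * z d ω) ∂μ =
      (if a = b then if c = d then 1 else 0 else 0) +
      (if a = c then if b = d then 1 else 0 else 0) +
      (if b = c then if a = d then 1 else 0 else 0) +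
      (if a = b then if a = c then if a = d then (∫ ω, z a ω ^ 4 ∂μ) - 3 else 0 else 0
        else 0) := by
  have single {a b c d : ι} (hb : a ≠ b) (hc : a ≠ c) (hd : a ≠ d) :=
    integral_mul_mul_mul_eq_zero hindep hmean hmom hb hc hd
  have pair {a b : ι} (h : a ≠ b) := integral_sq_mul_sq_eq_one hindep hvar hmom h
  by_cases hab : a = b
  · subst hab
    by_cases hac : a = c
    · subst hac
      by_cases had : a = d
      · subst had
        have : ∀ ω, z a ω * z a ω * (z a ω * z a ω) = z a ω ^ 4 := fun ω => by ring
        simp only [this, if_true]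
        ring
      · simp only [if_true, if_neg had, add_zero]
        rw [← single (Ne.symm had) (Ne.symm had) (Ne.symm had)]
        exact integral_congr_ae (.of_forall fun ω => by ring)
    · by_cases hcd : c = d
      · subst hcd
        simp only [if_true, if_neg hac, add_zero]
        rw [← pair hac]
        exact integral_congr_ae (.of_forall fun ω => by ring)
      · simp only [if_true, if_neg hac, if_neg hcd, add_zero]
        rw [← single (Ne.symm hac) (Ne.symm hac) hcd]
        exact integral_congr_ae (.of_forall fun ω => by ring)
  · by_cases hac : a = c
    · subst hac
      by_cases hbd : b = d
      · subst hbd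
        simp only [if_true, if_neg hab, if_neg (Ne.symm hab), add_zero, zero_add]
        rw [← pair hab]
        exact integral_congr_ae (.of_forall fun ω => by ring)
      · simp only [if_true, if_neg hab, if_neg (Ne.symm hab), if_neg hbd, add_zero]
        rw [← single (Ne.symm hab) (Ne.symm hab) hbd]
        exact integral_congr_ae (.of_forall fun ω => by ring)
    · by_cases had : a = d
      · subst had
        by_cases hbc : b = c
        · subst hbc
          simp only [if_true, if_neg hab, add_zero, zero_add]
          rw [← pair hab]
          exact integral_congr_ae (.of_forall fun ω => by ring)
        · simp only [if_neg hab, if_neg hac, if_neg hbc, add_zero]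
          rw [← single (Ne.symm hab) hbc (Ne.symm hab)]
          exact integral_congr_ae (.of_forall fun ω => by ring)
      · simp only [if_neg hab, if_neg hac, if_neg had, ite_self, add_zero]
        rw [← single hab hac had]
        exact integral_congr_ae (.of_forall fun ω => by ring)

end Moments

section LinearImage

variable {Ω : Type*} [MeasurableSpace Ω] {μ : Measure Ω} {p : ℕ} {z : Fin p → Ω → ℝ}

lemma integral_linear_mul_linear [IsFiniteMeasure μ] (hindep : iIndepFun z μ)
    (hmean : ∀ k, ∫ ω, z k ω ∂μ = 0) (hvar : ∀ k, ∫ ω, z k ω ^ 2 ∂μ = 1)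
    (hmom : ∀ k, MemLp (z k) 4 μ) (u v : Fin p → ℝ) :
    ∫ ω, (∑ a, u a * z a ω) * (∑ b, v b * z b ω) ∂μ = ∑ a, u a * v a := by
  have expand : ∀ ω, (∑ a, u a * z a ω) * (∑ b, v b * z b ω) =
      ∑ a, ∑ b, u a * v b * (z a ω * z b ω) := fun ω => by
    rw [Finset.sum_mul_sum]
    exact Finset.sum_congr rfl fun a _ => Finset.sum_congr rfl fun b _ => by ring
  have hint := integrable_mul_of_memLp_four hmom
  simp_rw [expand]
  rw [integral_finsetSum _ fun a _ => integrable_finsetSum _ fun b _ =>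
    (hint a b).const_mul _]
  refine Finset.sum_congr rfl fun a _ => ?_
  rw [integral_finsetSum _ fun b _ => (hint a b).const_mul _]
  simp [integral_const_mul, integral_mul_eq_ite hindep hmean hvar hmom]

lemma integral_linear_mul_linear_mul_linear [IsFiniteMeasure μ] (hindep : iIndepFun z μ)
    (hmean : ∀ k, ∫ ω, z k ω ∂μ = 0) (hmom : ∀ k, MemLp (z k) 4 μ) (u v w : Fin p → ℝ) :
    ∫ ω, (∑ a, u a * z a ω) * (∑ b, v b * z b ω) * (∑ c, w c * z c ω) ∂μ =
      ∑ a, u a * v a * w a * ∫ ω, z a ω ^ 3 ∂μ := by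
  have expand : ∀ ω, (∑ a, u a * z a ω) * (∑ b, v b * z b ω) * (∑ c, w c * z c ω) =
      ∑ a, ∑ b, ∑ c, u a * v b * w c * (z a ω * z b ω * z c ω) := fun ω => by
    rw [Finset.sum_mul_sum, Finset.sum_mul]
    refine Finset.sum_congr rfl fun a _ => ?_
    rw [Finset.sum_mul_sum]
    exact Finset.sum_congr rfl fun b _ => Finset.sum_congr rfl fun c _ => by ring
  have hint := integrable_mul_mul_of_memLp_four hmom
  simp_rw [expand]
  rw [integral_finsetSum _ fun a _ => integrable_finsetSum _ fun b _ =>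
    integrable_finsetSum _ fun c _ => (hint a b c).const_mul _]
  refine Finset.sum_congr rfl fun a _ => ?_
  rw [integral_finsetSum _ fun b _ => integrable_finsetSum _ fun c _ =>
    (hint a b c).const_mul _]
  simp_rw [integral_finsetSum _ fun c _ => (hint a _ c).const_mul _, integral_const_mul,
    integral_mul_mul_eq_ite hindep hmean hmom]
  rw [Finset.sum_comm]
  simp

lemma integral_linear_mul_linear_mul_linear_mul_linear (hindep : iIndepFun z μ)
    (hmean : ∀ k, ∫ ω, z k ω ∂μ = 0) (hvar : ∀ k, ∫ ω, z k ω ^ 2 ∂μ = 1)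
    (hmom : ∀ k, MemLp (z k) 4 μ) (u v w x : Fin p → ℝ) :
    ∫ ω, (∑ a, u a * z a ω) * (∑ b, v b * z b ω) *
        ((∑ c, w c * z c ω) * (∑ d, x d * z d ω)) ∂μ =
      (∑ a, u a * v a) * (∑ a, w a * x a) + (∑ a, u a * w a) * (∑ a, v a * x a) +
      (∑ a, v a * w a) * (∑ a, u a * x a) +
      ∑ a, u a * v a * w a * x a * ((∫ ω, z a ω ^ 4 ∂μ) - 3) := by
  have expand : ∀ ω, (∑ a, u a * z a ω) * (∑ b, v b * z b ω) *
        ((∑ c, w c * z c ω) * (∑ d, x d * z d ω)) =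
      ∑ a, ∑ b, ∑ c, ∑ d, u a * v b * w c * x d * (z a ω * z b ω * (z c ω * z d ω)) :=
    fun ω => by
      rw [Finset.sum_mul_sum, Finset.sum_mul_sum, Finset.sum_mul]
      refine Finset.sum_congr rfl fun a _ => ?_
      rw [Finset.sum_mul]
      refine Finset.sum_congr rfl fun b _ => ?_
      rw [Finset.mul_sum]
      refine Finset.sum_congr rfl fun c _ => ?_
      rw [Finset.mul_sum]
      exact Finset.sum_congr rfl fun d _ => by ring
  have hint := integrable_mul_mul_mul_of_memLp_four hmom
  simp_rw [expand]
  rw [integral_finsetSum _ fun a _ => integrable_finsetSum _ fun b _ =>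
    integrable_finsetSum _ fun c _ => integrable_finsetSum _ fun d _ =>
      (hint a b c d).const_mul _]
  simp_rw [integral_finsetSum _ fun b _ => integrable_finsetSum _ fun c _ =>
    integrable_finsetSum _ fun d _ => (hint _ b c d).const_mul _,
    integral_finsetSum _ fun c _ => integrable_finsetSum _ fun d _ =>
      (hint _ _ c d).const_mul _,
    integral_finsetSum _ fun d _ => (hint _ _ _ d).const_mul _, integral_const_mul,
    integral_mul_mul_mul_eq_ite hindep hmean hvar hmom, mul_add, Finset.sum_add_distrib]
  simp only [mul_ite, mul_one, mul_zero, Finset.sum_ite_irrel, Finset.sum_const_zero,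
    Finset.sum_ite_eq, Finset.mem_univ, if_true, Finset.sum_mul_sum]
  congr 1
  congr 1
  · congr 1
    · exact Finset.sum_congr rfl fun a _ => Finset.sum_congr rfl fun b _ => by ring
    · exact Finset.sum_congr rfl fun a _ => Finset.sum_congr rfl fun b _ => by ring
  · rw [Finset.sum_comm]
    exact Finset.sum_congr rfl fun a _ => Finset.sum_congr rfl fun b _ => by ring

/-- The third cumulant matrices of a linear image of a vector with independent components. -/
lemma thirdCumulantMatrix_linear_apply [IsFiniteMeasure μ] (hindep : iIndepFun z μ)
    (hmean : ∀ k, ∫ ω, z k ω ∂μ = 0) (hmom : ∀ k, MemLp (z k) 4 μ)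
    (A : Matrix (Fin p) (Fin p) ℝ) (i k l : Fin p) :
    thirdCumulantMatrix μ (fun j ω => ∑ k, A j k * z k ω) i k l =
      ∑ a, A i a * A k a * A l a * ∫ ω, z a ω ^ 3 ∂μ :=
  integral_linear_mul_linear_mul_linear hindep hmean hmom (A i) (A k) (A l)

/-- The fourth cumulant matrices of a linear image of a vector with independent standardized
components. -/
lemma fourthCumulantMatrix_linear_apply [IsFiniteMeasure μ] (hindep : iIndepFun z μ)
    (hmean : ∀ k, ∫ ω, z k ω ∂μ = 0) (hvar : ∀ k, ∫ ω, z k ω ^ 2 ∂μ = 1)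
    (hmom : ∀ k, MemLp (z k) 4 μ) (A : Matrix (Fin p) (Fin p) ℝ) (i j k l : Fin p) :
    fourthCumulantMatrix μ (fun j ω => ∑ k, A j k * z k ω) i j k l =
      ∑ a, A i a * A j a * A k a * A l a * ((∫ ω, z a ω ^ 4 ∂μ) - 3) := by
  simp only [fourthCumulantMatrix, Matrix.of_apply,
    integral_linear_mul_linear hindep hmean hvar hmom,
    integral_linear_mul_linear_mul_linear_mul_linear hindep hmean hvar hmom]
  ring

end LinearImage

/-- Let `z` have independent standardized components with finite fourth
moments, `γ_k = E[z_k^3]`, `κ_k = E[z_k^4] − 3`, and let `U` be orthogonal. Then the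
compound cumulant matrices of `Uz` are explicitly
`C^3(Uz) = U diag(c_1 γ_1, ..., c_p γ_p) Uᵀ` with `c_k = ∑_i u_{ik}`, and
`C^4(Uz) = U diag(κ_1, ..., κ_p) Uᵀ`. -/
theorem compound_cumulant_matrices_explicit
    {Ω : Type*} [MeasurableSpace Ω] (μ : Measure Ω) [IsProbabilityMeasure μ]
    (p : ℕ) (z : Fin p → Ω → ℝ)
    (hindep : iIndepFun z μ)
    (hmean : ∀ k, ∫ ω, z k ω ∂μ = 0)
    (hvar : ∀ k, ∫ ω, (z k ω) ^ 2 ∂μ = 1)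
    (hmom : ∀ k, MemLp (z k) 4 μ)
    (γ : Fin p → ℝ) (hγ : ∀ k, γ k = ∫ ω, (z k ω) ^ 3 ∂μ)
    (κ : Fin p → ℝ) (hκ : ∀ k, κ k = (∫ ω, (z k ω) ^ 4 ∂μ) - 3)
    (U : Matrix (Fin p) (Fin p) ℝ) (hU : U * Uᵀ = 1) :
    (∑ i, thirdCumulantMatrix μ (fun j ω => ∑ k, U j k * z k ω) i
        = U * Matrix.diagonal (fun k => (∑ i, U i k) * γ k) * Uᵀ) ∧
    (∑ i, fourthCumulantMatrix μ (fun j ω => ∑ k, U j k * z k ω) i i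
        = U * Matrix.diagonal κ * Uᵀ) := by
  constructor
  · ext k l
    simp only [Matrix.sum_apply, thirdCumulantMatrix_linear_apply hindep hmean hmom,
      Matrix.mul_apply (N := Uᵀ), Matrix.mul_diagonal, Matrix.transpose_apply, ← hγ]
    rw [Finset.sum_comm]
    refine Finset.sum_congr rfl fun a _ => ?_
    simp_rw [Finset.sum_mul, Finset.mul_sum, Finset.sum_mul]
    exact Finset.sum_congr rfl fun i _ => by ring
  · have hU' : Uᵀ * U = 1 := mul_eq_one_comm.mp hU
    have hcol : ∀ a, ∑ i, U i a * U i a = 1 := fun a => by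
      simpa [Matrix.mul_apply] using congrArg (fun M : Matrix (Fin p) (Fin p) ℝ => M a a) hU'
    ext k l
    simp only [Matrix.sum_apply, fourthCumulantMatrix_linear_apply hindep hmean hvar hmom,
      Matrix.mul_apply (N := Uᵀ), Matrix.mul_diagonal, Matrix.transpose_apply, ← hκ]
    rw [Finset.sum_comm]
    refine Finset.sum_congr rfl fun a _ => ?_
    simp_rw [← Finset.sum_mul, hcol]
    ring
end

section
/- (Key step in the proof of Lemma 6) Let x be a p-variate random vector with E[x] = 0 and finite third moments, and let U and V be p × p orthogonal matrices. Write u_d for the rows of U and w_d for the rows of W = UV. Then the JADE-type third-cumulant objective is invariant: ∑_{i=1}^p ∑_{d=1}^p (u_d^T C^{3i}(V x) u_d)^2 = ∑_{i=1}^p ∑_{d=1}^p (w_d^T C^{3i}(x) w_d)^2. -/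
open MeasureTheory ProbabilityTheory Matrix

/-- A product of three functions in `L³` is integrable. -/
theorem integrable_mul_mul_of_memLp_three {Ω : Type*} [MeasurableSpace Ω] {μ : Measure Ω}
    {f g h : Ω → ℝ} (hf : MemLp f 3 μ) (hg : MemLp g 3 μ) (hh : MemLp h 3 μ) :
    Integrable (fun ω => f ω * g ω * h ω) μ := by
  have hprod := MemLp.prod' (s := Finset.univ) (f := ![f, g, h]) (p := fun _ : Fin 3 => 3)
    (μ := μ) (by intro i _; fin_cases i <;> simpa)
  rw [← memLp_one_iff_integrable]
  simpa [ENNReal.mul_inv_cancel, Fin.prod_univ_three] using hprod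

/-- Transformation of the third cumulant matrices under a linear map. -/
theorem thirdCumulantMatrix_linear {Ω : Type*} [MeasurableSpace Ω] {μ : Measure Ω}
    {p : ℕ} {x : Fin p → Ω → ℝ} (hx : ∀ k, MemLp (x k) 3 μ)
    (V : Matrix (Fin p) (Fin p) ℝ) (i : Fin p) :
    thirdCumulantMatrix μ (fun j ω => ∑ k, V j k * x k ω) i
      = ∑ a, V i a • (V * thirdCumulantMatrix μ x a * Vᵀ) := by
  have hint (a b c : Fin p) := integrable_mul_mul_of_memLp_three (hx a) (hx b) (hx c)
  ext k l
  have hexpand (ω : Ω) :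
      (∑ a, V i a * x a ω) * (∑ b, V k b * x b ω) * (∑ c, V l c * x c ω)
        = ∑ a, ∑ c, ∑ b, V i a * V k b * V l c * (x a ω * x b ω * x c ω) := by
    rw [mul_assoc, Finset.sum_mul]
    refine Finset.sum_congr rfl fun a _ => ?_
    rw [Finset.sum_mul_sum, Finset.sum_comm, Finset.mul_sum]
    refine Finset.sum_congr rfl fun c _ => ?_
    rw [Finset.mul_sum]
    refine Finset.sum_congr rfl fun b _ => ?_
    ring
  simp only [thirdCumulantMatrix, Matrix.of_apply, hexpand, Matrix.sum_apply, Matrix.smul_apply,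
    Matrix.mul_apply, Matrix.transpose_apply, smul_eq_mul]
  rw [integral_finsetSum _ fun a _ => integrable_finsetSum _ fun c _ =>
    integrable_finsetSum _ fun b _ => (hint a b c).const_mul _]
  refine Finset.sum_congr rfl fun a _ => ?_
  rw [integral_finsetSum _ fun c _ => integrable_finsetSum _ fun b _ => (hint a b c).const_mul _,
    Finset.mul_sum]
  refine Finset.sum_congr rfl fun c _ => ?_
  rw [integral_finsetSum _ fun b _ => (hint a b c).const_mul _, Finset.sum_mul, Finset.mul_sum]
  refine Finset.sum_congr rfl fun b _ => ?_
  rw [integral_const_mul]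
  ring

/-- A matrix with orthonormal columns preserves the sum of squares. -/
theorem sum_sq_mulVec_of_transpose_mul_self {m n : Type*} [Fintype m] [Fintype n] [DecidableEq n]
    {V : Matrix m n ℝ} (hV : Vᵀ * V = 1) (y : n → ℝ) :
    ∑ i, (V *ᵥ y) i ^ 2 = ∑ j, y j ^ 2 := by
  have h : V *ᵥ y ⬝ᵥ V *ᵥ y = y ⬝ᵥ y := by
    rw [Matrix.dotProduct_mulVec, ← Matrix.mulVec_transpose,
      Matrix.mulVec_mulVec, hV, Matrix.one_mulVec]
  simpa [dotProduct, sq] using h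

/-- key step in the proof of Lemma 6: For a centered random vector `x` with
finite third moments and orthogonal `U`, `V`, writing `u_d` for the rows of `U` and `w_d`
for the rows of `W = UV`, the JADE-type third-cumulant objective is invariant:
`∑_i ∑_d (u_dᵀ C^{3i}(Vx) u_d)² = ∑_i ∑_d (w_dᵀ C^{3i}(x) w_d)²`.
(Here `u_dᵀ M u_d = (U M Uᵀ)_{dd}` and `w_dᵀ M w_d = (UV M (UV)ᵀ)_{dd}`.) -/
theorem jade_third_cumulant_objective_invariance
    {Ω : Type*} [MeasurableSpace Ω] (μ : Measure Ω) [IsProbabilityMeasure μ]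
    (p : ℕ) (x : Fin p → Ω → ℝ)
    (hmeas : ∀ k, MemLp (x k) 3 μ)
    (hmean : ∀ k, ∫ ω, x k ω ∂μ = 0)
    (U V : Matrix (Fin p) (Fin p) ℝ) (hU : U * Uᵀ = 1) (hV : V * Vᵀ = 1) :
    ∑ i, ∑ d, ((U * thirdCumulantMatrix μ (fun j ω => ∑ k, V j k * x k ω) i * Uᵀ) d d) ^ 2
      = ∑ i, ∑ d, (((U * V) * thirdCumulantMatrix μ x i * (U * V)ᵀ) d d) ^ 2 := by
  have hV' : Vᵀ * V = 1 := mul_eq_one_comm.mp hV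
  rw [Finset.sum_comm, Finset.sum_comm (f := fun i d =>
    (((U * V) * thirdCumulantMatrix μ x i * (U * V)ᵀ) d d) ^ 2)]
  refine Finset.sum_congr rfl fun d _ => ?_
  rw [← sum_sq_mulVec_of_transpose_mul_self hV'
    fun i => ((U * V) * thirdCumulantMatrix μ x i * (U * V)ᵀ) d d]
  refine Finset.sum_congr rfl fun i _ => ?_
  rw [thirdCumulantMatrix_linear hmeas, Matrix.mul_sum, Matrix.sum_mul, Matrix.sum_apply]
  simp [mulVec, dotProduct, Matrix.transpose_mul, Matrix.mul_assoc]
end
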